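/- Let q > 3 be a prime power. If there exists a local permutation polynomial f ∈ F_q[x_1,…,x_n] in reduced form (degree less than q in each variable) of total degree n(q-2) (the maximum possible degree of an LPP), then for every m with 1 ≤ m ≤ n there exists a local permutation polynomial in F_q[x_1,…,x_m] in reduced form of total degree m(q-2). -/

import Mathlib

open MvPolynomial

/-- If the reduced polynomial `p` is summed over all values, only its coefficient of degree
`#F - 1` survives. -/
lemma Polynomial.sum_eval_eq_neg_coeff {F : Type*} [Field F] [Fintype F] (p : Polynomial F)
    (hp : p.natDegree < Fintype.card F) :
    ∑ c : F, p.eval c = -p.coeff (Fintype.card F - 1) := by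
  classical
  have hq : 1 < Fintype.card F := Fintype.one_lt_card
  have htop : ∑ c : F, c ^ (Fintype.card F - 1) = -1 := by
    have (c : F) : c ^ (Fintype.card F - 1) = 1 - if c = 0 then 1 else 0 := by
      split_ifs with hc
      · subst hc
        rw [zero_pow (by omega), sub_self]
      · rw [FiniteField.pow_card_sub_one_eq_one c hc, sub_zero]
    simp [this]
  simp_rw [Polynomial.eval_eq_sum_range' hp]
  rw [Finset.sum_comm]
  simp_rw [← Finset.mul_sum]
  rw [Finset.sum_eq_single (Fintype.card F - 1), htop, mul_neg_one]
  · intro i hi hne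
    rw [FiniteField.sum_pow_lt_card_sub_one F i (by have := Finset.mem_range.1 hi; omega), mul_zero]
  · intro h
    exact absurd (Finset.mem_range.2 (by omega)) h

namespace MvPolynomial

/-- `f` is a local permutation polynomial: fixing all variables but one gives a bijection. -/
def IsLocalPermutation {σ F : Type*} [DecidableEq σ] [CommSemiring F]
    (f : MvPolynomial σ F) : Prop :=
  ∀ (i : σ) (x : σ → F), Function.Bijective fun c : F => eval (Function.update x i c) f

lemma IsLocalPermutation.rename_equiv {σ τ F : Type*} [DecidableEq σ] [DecidableEq τ]
    [CommSemiring F] {f : MvPolynomial σ F} (hf : f.IsLocalPermutation) (e : σ ≃ τ) :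
    (rename e f).IsLocalPermutation := by
  intro i x
  have h := hf (e.symm i) (x ∘ e)
  have heq (c : F) :
      Function.update x i c ∘ e = Function.update (x ∘ e) (e.symm i) c := by
    rw [← Function.update_comp_equiv]
  simpa only [eval_rename, heq] using h

section FiniteField

variable {F : Type*} [Field F] [Fintype F]

/-- A reduced local permutation polynomial has degree at most `#F - 2` in its first variable. -/
lemma IsLocalPermutation.degreeOf_zero_le {n : ℕ} {f : MvPolynomial (Fin (n + 1)) F}
    (hf : f.IsLocalPermutation) (hq : 2 < Fintype.card F)
    (hred : ∀ i, f.degreeOf i < Fintype.card F) :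
    f.degreeOf 0 ≤ Fintype.card F - 2 := by
  have hcoeff : (finSuccEquiv F n f).coeff (Fintype.card F - 1) = 0 := by
    refine eq_zero_of_eval_zero_at_prod_finset _ (fun _ => Finset.univ)
      (fun i => (degreeOf_coeff_finSuccEquiv f i _).trans_lt (hred i.succ)) fun x _ => ?_
    have hdeg : ((finSuccEquiv F n f).map (eval x)).natDegree < Fintype.card F :=
      Polynomial.natDegree_map_le.trans_lt (natDegree_finSuccEquiv f ▸ hred 0)
    have hsum := Polynomial.sum_eval_eq_neg_coeff _ hdeg
    have hbij := hf 0 (Fin.cons 0 x)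
    simp only [Fin.update_cons_zero, eval_eq_eval_mv_eval'] at hbij
    rw [hbij.sum_comp (fun c : F => c), Polynomial.coeff_map] at hsum
    have hzero := FiniteField.sum_pow_lt_card_sub_one F 1 (by omega)
    simp only [pow_one] at hzero
    simpa [hzero] using hsum.symm
  rw [← natDegree_finSuccEquiv]
  have hlt : (finSuccEquiv F n f).natDegree < Fintype.card F :=
    natDegree_finSuccEquiv f ▸ hred 0
  by_contra! hgt
  have hnat : (finSuccEquiv F n f).natDegree = Fintype.card F - 1 := by omega
  have hzero : finSuccEquiv F n f = 0 := by
    rw [← Polynomial.leadingCoeff_eq_zero, Polynomial.leadingCoeff, hnat, hcoeff]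
  rw [hzero, Polynomial.natDegree_zero] at hgt
  omega

/-- A reduced local permutation polynomial has degree at most `#F - 2` in each variable. -/
lemma IsLocalPermutation.degreeOf_le {n : ℕ} {f : MvPolynomial (Fin n) F}
    (hf : f.IsLocalPermutation) (hq : 2 < Fintype.card F)
    (hred : ∀ i, f.degreeOf i < Fintype.card F) (i : Fin n) :
    f.degreeOf i ≤ Fintype.card F - 2 := by
  cases n with
  | zero => exact i.elim0
  | succ n =>
    have hdeg (j : Fin (n + 1)) :
        (rename (Equiv.swap 0 i) f).degreeOf (Equiv.swap 0 i j) = f.degreeOf j :=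
      degreeOf_rename_of_injective (Equiv.injective _) j
    have h := (hf.rename_equiv (Equiv.swap 0 i)).degreeOf_zero_le hq fun j => by
      rw [← Equiv.swap_apply_self 0 i j, hdeg]
      exact hred _
    have hi := hdeg i
    rw [Equiv.swap_apply_right] at hi
    rwa [hi] at h

/-- The first variable of a local permutation polynomial can be specialized so that the
coefficient of a monomial occurring in it stays nonzero. -/
lemma IsLocalPermutation.exists_specialization {n : ℕ} {f : MvPolynomial (Fin (n + 1)) F}
    (hf : f.IsLocalPermutation) (hred : ∀ i, f.degreeOf i < Fintype.card F)
    {t : Fin n →₀ ℕ} {d : ℕ} (hd : f.coeff (t.cons d) ≠ 0) :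
    ∃ g : MvPolynomial (Fin n) F, (∀ i, g.degreeOf i < Fintype.card F) ∧
      g.IsLocalPermutation ∧ g.coeff t ≠ 0 := by
  set P := finSuccEquiv F n f with hP
  have hPdeg : P.natDegree < Fintype.card F := natDegree_finSuccEquiv f ▸ hred 0
  have hcoeff (a : F) : coeff t (P.eval (C a)) =
      ∑ j ∈ Finset.range (Fintype.card F), coeff t (P.coeff j) * a ^ j := by
    rw [Polynomial.eval_eq_sum_range' hPdeg, coeff_sum]
    refine Finset.sum_congr rfl fun j _ => ?_
    rw [← C_pow, mul_comm, coeff_C_mul, mul_comm]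
  have hex : ∃ a : F, coeff t (P.eval (C a)) ≠ 0 := by
    by_contra! hall
    let p : Polynomial F :=
      ∑ j ∈ Finset.range (Fintype.card F), Polynomial.monomial j (coeff t (P.coeff j))
    have hpdeg : p.degree < Fintype.card F := by
      refine (Polynomial.degree_sum_le _ _).trans_lt ?_
      rw [Finset.sup_lt_iff (WithBot.bot_lt_coe _)]
      intro j hj
      exact (Polynomial.degree_monomial_le _ _).trans_lt
        (Nat.cast_lt.2 (Finset.mem_range.1 hj))
    have hp : p = 0 :=
      Polynomial.eq_zero_of_degree_lt_of_eval_finset_eq_zero Finset.univ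
        (by simpa using hpdeg) fun a _ => by
          simpa [p, Polynomial.eval_finsetSum, hcoeff] using hall a
    have hdlt : d < Fintype.card F := by
      refine lt_of_le_of_lt ?_ (hred 0)
      simpa using degreeOf_le_iff.1 (le_refl (f.degreeOf 0)) _ (mem_support_iff.2 hd)
    have hpd := congrArg (fun r => Polynomial.coeff r d) hp
    simp only [p, Polynomial.finsetSum_coeff, Polynomial.coeff_monomial, Polynomial.coeff_zero,
      Finset.sum_ite_eq', Finset.mem_range, hdlt, if_true, hP, finSuccEquiv_coeff_coeff] at hpd
    exact hd hpd
  obtain ⟨a, ha⟩ := hex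
  refine ⟨P.eval (C a), fun i => ?_, fun i x => ?_, ha⟩
  · refine lt_of_le_of_lt ?_ (hred i.succ)
    rw [Polynomial.eval_eq_sum_range]
    refine (degreeOf_sum_le _ _ _).trans (Finset.sup_le fun j _ => ?_)
    rw [← C_pow]
    exact (degreeOf_mul_C_le _ _ _).trans (degreeOf_coeff_finSuccEquiv f i j)
  · have heval (y : Fin n → F) :
        eval y (P.eval (C a)) = eval (Fin.cons a y : Fin (n + 1) → F) f := by
      rw [eval_eq_eval_mv_eval', Polynomial.eval_map, Polynomial.eval, Polynomial.hom_eval₂]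
      simp [hP]
    have h := hf i.succ (Fin.cons a x)
    simpa only [heval, Fin.cons_update] using h

end FiniteField

/-- A polynomial of degree at most `d > 0` in each of `n > 0` variables has total degree `n * d` if
and only if the product of the `d`-th powers of all variables occurs in it. -/
lemma totalDegree_eq_mul_iff {R : Type*} [CommSemiring R] {n d : ℕ} (hn : 0 < n) (hd : 0 < d)
    {f : MvPolynomial (Fin n) R} (hf : ∀ i, f.degreeOf i ≤ d) :
    f.totalDegree = n * d ↔ f.coeff (Finsupp.equivFunOnFinite.symm fun _ => d) ≠ 0 := by
  have hle (s) (hs : s ∈ f.support) (i : Fin n) : s i ≤ d := degreeOf_le_iff.1 (hf i) s hs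
  have hsum (s : Fin n →₀ ℕ) : (s.sum fun _ e => e) = ∑ i, s i :=
    Finsupp.sum_fintype _ _ fun _ => rfl
  constructor
  · intro h
    have hne : f.support.Nonempty := by
      rw [support_nonempty]
      rintro rfl
      rw [totalDegree_zero] at h
      exact (Nat.mul_pos hn hd).ne h
    obtain ⟨s, hs, hmax⟩ := Finset.exists_mem_eq_sup f.support hne fun s => s.sum fun _ e => e
    have hs' : ∑ i, s i = ∑ _i : Fin n, d := by
      rw [← hsum, ← hmax]
      simpa [totalDegree] using h
    have heq := (Finset.sum_eq_sum_iff_of_le fun i _ => hle s hs i).1 hs'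
    have : s = Finsupp.equivFunOnFinite.symm fun _ => d := by
      ext i
      simpa using heq i (Finset.mem_univ i)
    rw [← this]
    exact mem_support_iff.1 hs
  · intro h
    apply le_antisymm
    · refine Finset.sup_le fun s hs => ?_
      rw [hsum]
      simpa using Finset.sum_le_sum fun i (_ : i ∈ Finset.univ) => hle s hs i
    · have := le_totalDegree (mem_support_iff.2 h)
      rw [hsum] at this
      simpa using this

/-- A reduced local permutation polynomial in which the product of the `d`-th
powers of all variables occurs can be specialized to one of the same shape in fewer variables. -/
lemma IsLocalPermutation.exists_fewer_vars {F : Type*} [Field F] [Fintype F] {m n d : ℕ}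
    (hmn : m ≤ n) {f : MvPolynomial (Fin n) F} (hf : f.IsLocalPermutation)
    (hred : ∀ i, f.degreeOf i < Fintype.card F)
    (hd : f.coeff (Finsupp.equivFunOnFinite.symm fun _ => d) ≠ 0) :
    ∃ g : MvPolynomial (Fin m) F, (∀ i, g.degreeOf i < Fintype.card F) ∧
      g.IsLocalPermutation ∧ g.coeff (Finsupp.equivFunOnFinite.symm fun _ => d) ≠ 0 := by
  induction n, hmn using Nat.le_induction with
  | base => exact ⟨f, hred, hf, hd⟩
  | succ n _ ih =>
    have hcons : (Finsupp.equivFunOnFinite.symm fun _ : Fin (n + 1) => d) =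
        (Finsupp.equivFunOnFinite.symm fun _ : Fin n => d).cons d := by
      ext i
      cases i using Fin.cases <;> simp
    rw [hcons] at hd
    obtain ⟨g, hgred, hg, hgd⟩ := hf.exists_specialization hred hd
    exact ih hg hgred hgd

end MvPolynomial

/-- If over `F_q` (`q > 3`) there is a local permutation polynomial in `n` variables, in
reduced form, of maximum total degree `n(q-2)`, then for each `1 ≤ m ≤ n` there is one
in `m` variables, in reduced form, of maximum total degree `m(q-2)`. -/
theorem lpp_max_degree_fewer_vars {F : Type*} [Field F] [Fintype F] [DecidableEq F]
    (hq : 3 < Fintype.card F)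
    {n : ℕ} (f : MvPolynomial (Fin n) F)
    (hred : ∀ i : Fin n, f.degreeOf i < Fintype.card F)
    (hlpp : ∀ (i : Fin n) (x : Fin n → F),
      Function.Bijective fun c : F => eval (Function.update x i c) f)
    (hdeg : f.totalDegree = n * (Fintype.card F - 2)) :
    ∀ m : ℕ, 1 ≤ m → m ≤ n →
      ∃ g : MvPolynomial (Fin m) F,
        (∀ i : Fin m, g.degreeOf i < Fintype.card F) ∧
        (∀ (i : Fin m) (x : Fin m → F),
          Function.Bijective fun c : F => eval (Function.update x i c) g) ∧
        g.totalDegree = m * (Fintype.card F - 2) := by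
  intro m hm hmn
  have hf : f.IsLocalPermutation := hlpp
  have hcoeff := (totalDegree_eq_mul_iff (by omega) (by omega)
    (hf.degreeOf_le (by omega) hred)).1 hdeg
  obtain ⟨g, hgred, hg, hgcoeff⟩ := hf.exists_fewer_vars hmn hred hcoeff
  exact ⟨g, hgred, hg, (totalDegree_eq_mul_iff hm (by omega)
    (hg.degreeOf_le (by omega) hgred)).2 hgcoeff⟩
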